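/- Let 0 < α < 1, β ≥ 0 and T > 0, and assume E_{α, 1+β/α, 1+β/α}(−π² T^{α+β}) ≠ 0. Define ū(t,x) = (t^α E_{α,1+β/α,1+β/α}(−π² t^{α+β}) / (T^α E_{α,1+β/α,1+β/α}(−π² T^{α+β}))) · sin(πx) for t > 0 with ū(0,x) = 0, and h̄(x) = (Γ(α+1)/(T^α E_{α,1+β/α,1+β/α}(−π² T^{α+β}))) · sin(πx). Then for all (t,x) ∈ (0,T) × (0,1): ({}_{RL}D^α_{0t} ū)(t,x) = t^β ∂²_xū(t,x) + h̄(x); moreover ū(t,0) = ū(t,1) = 0 for all t ∈ [0,T], lim_{t→0⁺} (I^{1−α}_{0t} ū)(t,x) = 0 for all x ∈ [0,1], and ū(T,x) = sin(πx) for all x ∈ [0,1]. -/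

import Mathlib

open MeasureTheory
open scoped BigOperators Real

/-- The real Kilbas generalized Mittag-Leffler function
`E_{α,m,n}(x) = 1 + Σ_{k≥1} (∏_{j=0}^{k-1} Γ(α(jm+n)+1)/Γ(α(jm+n+1)+1)) x^k`. -/
noncomputable def kilbasML (α m n : ℝ) (x : ℝ) : ℝ :=
  ∑' k : ℕ, (∏ j ∈ Finset.range k,
      Real.Gamma (α * ((j : ℝ) * m + n) + 1) /
        Real.Gamma (α * ((j : ℝ) * m + n + 1) + 1)) * x ^ k

/-- The scaled Beta integral, on the real line. -/
lemma integral_sub_rpow_mul_rpow {a b τ : ℝ} (ha : 0 < a) (hb : 0 < b) (hτ : 0 < τ) :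
    ∫ s in Set.Ioo 0 τ, (τ - s) ^ (a - 1) * s ^ (b - 1) =
      Real.Gamma a * Real.Gamma b / Real.Gamma (a + b) * τ ^ (a + b - 1) := by
  have h := Complex.betaIntegral_scaled (b : ℂ) (a : ℂ) hτ
  rw [Complex.betaIntegral_eq_Gamma_mul_div _ _ (by simpa) (by simpa),
    intervalIntegral.integral_of_le hτ.le, integral_Ioc_eq_integral_Ioo] at h
  rw [← Complex.ofReal_inj, ← integral_complex_ofReal]
  have hcongr : ∫ s in Set.Ioo 0 τ, (((τ - s) ^ (a - 1) * s ^ (b - 1) : ℝ) : ℂ) =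
      ∫ s in Set.Ioo 0 τ, (s : ℂ) ^ ((b : ℂ) - 1) * ((τ : ℂ) - s) ^ ((a : ℂ) - 1) := by
    refine setIntegral_congr_fun measurableSet_Ioo fun s hs => ?_
    have h₁ : 0 ≤ τ - s := (sub_pos.2 hs.2).le
    simp only [Complex.ofReal_mul, Complex.ofReal_cpow h₁, Complex.ofReal_cpow hs.1.le]
    push_cast
    ring
  rw [hcongr, h]
  simp only [Complex.ofReal_mul, Complex.ofReal_div, Complex.ofReal_cpow hτ.le,
    ← Complex.Gamma_ofReal]
  push_cast
  rw [add_comm (b : ℂ) a]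
  ring

lemma integrableOn_sub_rpow_mul_rpow {a b τ : ℝ} (ha : 0 < a) (hb : 0 < b) (hτ : 0 < τ) :
    IntegrableOn (fun s => (τ - s) ^ (a - 1) * s ^ (b - 1)) (Set.Ioo 0 τ) := by
  by_contra h
  have hzero := integral_undef h
  rw [integral_sub_rpow_mul_rpow ha hb hτ] at hzero
  have := Real.Gamma_pos_of_pos ha
  have := Real.Gamma_pos_of_pos hb
  have := Real.Gamma_pos_of_pos (add_pos ha hb)
  have := Real.rpow_pos_of_pos hτ (a + b - 1)
  exact absurd hzero (by positivity)

/-- A quantitative decay bound for `Γ(x) / Γ(x + α)`, from log-convexity of `Γ`. -/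
lemma Gamma_div_Gamma_add_le {α x : ℝ} (hα0 : 0 < α) (hα1 : α < 1) (hx : 1 ≤ x) :
    Real.Gamma x / Real.Gamma (x + α) ≤ 2 * x ^ (-α) := by
  have hx0 : 0 < x := by linarith
  have hG : 0 < Real.Gamma (x + α) := Real.Gamma_pos_of_pos (by linarith)
  have hconv := Real.Gamma_mul_add_mul_le_rpow_Gamma_mul_rpow_Gamma (s := x + α)
    (t := x + α + 1) (a := α) (b := 1 - α) (by linarith) (by linarith) hα0 (by linarith) (by ring)
  rw [show α * (x + α) + (1 - α) * (x + α + 1) = x + 1 by ring, Real.Gamma_add_one hx0.ne',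
    Real.Gamma_add_one (by linarith), Real.mul_rpow (by linarith) hG.le] at hconv
  have hsplit : Real.Gamma (x + α) ^ α *
      ((x + α) ^ (1 - α) * Real.Gamma (x + α) ^ (1 - α)) =
      (x + α) ^ (1 - α) * Real.Gamma (x + α) := by
    rw [mul_left_comm, ← Real.rpow_add hG, add_sub_cancel, Real.rpow_one]
  rw [hsplit] at hconv
  have hpow : (x + α) ^ (1 - α) ≤ 2 * x ^ (1 - α) := calc
    (x + α) ^ (1 - α) ≤ (2 * x) ^ (1 - α) :=
      Real.rpow_le_rpow (by linarith) (by linarith) (by linarith)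
    _ = 2 ^ (1 - α) * x ^ (1 - α) := Real.mul_rpow (by norm_num) hx0.le
    _ ≤ 2 * x ^ (1 - α) := by
      gcongr
      exact (Real.rpow_le_rpow_of_exponent_le (by norm_num) (by linarith)).trans_eq
        (Real.rpow_one 2)
  rw [div_le_iff₀ hG]
  refine le_of_mul_le_mul_left ?_ hx0
  calc x * Real.Gamma x ≤ (x + α) ^ (1 - α) * Real.Gamma (x + α) := hconv
    _ ≤ 2 * x ^ (1 - α) * Real.Gamma (x + α) := by gcongr
    _ = x * (2 * x ^ (-α) * Real.Gamma (x + α)) := by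
      rw [show 1 - α = 1 + -α by ring, Real.rpow_add hx0, Real.rpow_one]
      ring

lemma tendsto_Gamma_div_Gamma_add {α : ℝ} (hα0 : 0 < α) (hα1 : α < 1) :
    Filter.Tendsto (fun x => Real.Gamma x / Real.Gamma (x + α)) Filter.atTop (nhds 0) := by
  have hbound : Filter.Tendsto (fun x : ℝ => 2 * x ^ (-α)) Filter.atTop (nhds 0) := by
    simpa using (tendsto_rpow_neg_atTop hα0).const_mul 2
  refine squeeze_zero' ?_ ?_ hbound
  · filter_upwards [Filter.eventually_ge_atTop 1] with x hx
    exact (div_pos (Real.Gamma_pos_of_pos (by linarith))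
      (Real.Gamma_pos_of_pos (by linarith))).le
  · filter_upwards [Filter.eventually_ge_atTop 1] with x hx
    exact Gamma_div_Gamma_add_le hα0 hα1 hx

/-- The coefficients of `E_{α,m,n}` with `m = n = γ / α`. -/
noncomputable def kilbasCoeff (α γ : ℝ) (k : ℕ) : ℝ :=
  ∏ j ∈ Finset.range k, Real.Gamma (((j : ℝ) + 1) * γ + 1) /
    Real.Gamma (((j : ℝ) + 1) * γ + 1 + α)

lemma kilbasML_eq_tsum_kilbasCoeff {α : ℝ} (hα : α ≠ 0) (β x : ℝ) :
    kilbasML α (1 + β / α) (1 + β / α) x = ∑' k : ℕ, kilbasCoeff α (α + β) k * x ^ k := by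
  unfold kilbasML kilbasCoeff
  refine tsum_congr fun k => ?_
  congr 1
  refine Finset.prod_congr rfl fun j _ => ?_
  rw [show α * ((j : ℝ) * (1 + β / α) + (1 + β / α)) + 1 = ((j : ℝ) + 1) * (α + β) + 1 by
      field_simp,
    show α * ((j : ℝ) * (1 + β / α) + (1 + β / α) + 1) + 1 =
      ((j : ℝ) + 1) * (α + β) + 1 + α by field_simp; ring]

lemma kilbasCoeff_succ (α γ : ℝ) (k : ℕ) :
    kilbasCoeff α γ (k + 1) = kilbasCoeff α γ k * (Real.Gamma (((k : ℝ) + 1) * γ + 1) /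
      Real.Gamma (((k : ℝ) + 1) * γ + 1 + α)) :=
  Finset.prod_range_succ _ _

lemma kilbasCoeff_pos {α γ : ℝ} (hα : 0 < α) (hγ : 0 < γ) (k : ℕ) : 0 < kilbasCoeff α γ k :=
  Finset.prod_pos fun j _ => div_pos (Real.Gamma_pos_of_pos (by positivity))
    (Real.Gamma_pos_of_pos (by positivity))

lemma summable_kilbasCoeff_mul_pow {α γ : ℝ} (hα0 : 0 < α) (hα1 : α < 1) (hγ : 0 < γ) (r : ℝ) :
    Summable fun k => kilbasCoeff α γ k * r ^ k := by
  rcases eq_or_ne r 0 with rfl | hr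
  · refine summable_of_ne_finset_zero (s := {0}) fun k hk => ?_
    simp [zero_pow (by simpa using hk : k ≠ 0)]
  refine summable_of_ratio_test_tendsto_lt_one zero_lt_one
    (Filter.Eventually.of_forall fun k =>
      mul_ne_zero (kilbasCoeff_pos hα0 hγ k).ne' (pow_ne_zero k hr)) ?_
  have harg : Filter.Tendsto (fun k : ℕ => ((k : ℝ) + 1) * γ + 1) Filter.atTop Filter.atTop :=
    Filter.tendsto_atTop_add_const_right _ _
      ((Filter.tendsto_atTop_add_const_right _ _ tendsto_natCast_atTop_atTop).atTop_mul_const hγ)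
  have hlim := ((tendsto_Gamma_div_Gamma_add hα0 hα1).comp harg).mul_const |r|
  rw [zero_mul] at hlim
  refine hlim.congr fun k => ?_
  have hc := kilbasCoeff_pos hα0 hγ k
  have hc' := kilbasCoeff_pos hα0 hγ (k + 1)
  have hr' : 0 < |r| := abs_pos.2 hr
  simp only [Function.comp_apply, Real.norm_eq_abs, abs_mul, abs_pow, abs_of_pos hc,
    abs_of_pos hc']
  rw [kilbasCoeff_succ, pow_succ]
  field_simp

/-- The coefficients of the Riemann–Liouville derivative of order `α` of
`∑ₖ aₖ t^(α + kγ)`, as a power series in `t^γ`. -/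
noncomputable def rlDerivCoeff (α γ : ℝ) (a : ℕ → ℝ) (k : ℕ) : ℝ :=
  a k * (Real.Gamma (α + k * γ + 1) / Real.Gamma (k * γ + 1))

/-- The fractional integral of order `1 - α` of a power `t^(α + kγ)`. -/
lemma integral_sub_rpow_mul_rpow_add {α γ τ : ℝ} (hα0 : 0 < α) (hα1 : α < 1) (hγ : 0 < γ)
    (hτ : 0 < τ) (k : ℕ) :
    ∫ s in Set.Ioo 0 τ, (τ - s) ^ ((1 - α) - 1) * s ^ (α + k * γ) =
      Real.Gamma (1 - α) * (Real.Gamma (α + k * γ + 1) / Real.Gamma (k * γ + 1)) *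
        (τ ^ (k * γ + 1) / (k * γ + 1)) := by
  have h := integral_sub_rpow_mul_rpow (a := 1 - α) (b := α + k * γ + 1) (by linarith)
    (by positivity) hτ
  have hk : (0 : ℝ) < k * γ + 1 := by positivity
  rw [add_sub_cancel_right, show 1 - α + (α + k * γ + 1) = k * γ + 1 + 1 by ring,
    add_sub_cancel_right, Real.Gamma_add_one hk.ne'] at h
  rw [h]
  have := (Real.Gamma_pos_of_pos hk).ne'
  field_simp

lemma integrableOn_sub_rpow_mul_rpow_add {α γ τ : ℝ} (hα0 : 0 < α) (hα1 : α < 1) (hγ : 0 < γ)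
    (hτ : 0 < τ) (k : ℕ) :
    IntegrableOn (fun s => (τ - s) ^ ((1 - α) - 1) * s ^ (α + k * γ)) (Set.Ioo 0 τ) := by
  simpa using integrableOn_sub_rpow_mul_rpow (a := 1 - α) (b := α + k * γ + 1) (by linarith)
    (by positivity) hτ

lemma norm_mul_rpow_div_le {γ τ : ℝ} (hγ : 0 < γ) (hτ : 0 < τ) (b : ℝ) (k : ℕ) :
    ‖b * (τ ^ (k * γ + 1) / (k * γ + 1))‖ ≤ τ * (|b| * (τ ^ γ) ^ k) := by
  have hk : (1 : ℝ) ≤ k * γ + 1 := le_add_of_nonneg_left (by positivity)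
  have hpow : τ ^ (k * γ + 1) = τ * (τ ^ γ) ^ k := by
    rw [Real.rpow_add hτ, Real.rpow_one, mul_comm (k : ℝ), Real.rpow_mul_natCast hτ.le, mul_comm]
  rw [norm_mul, Real.norm_eq_abs, Real.norm_of_nonneg (by positivity), mul_left_comm, ← hpow]
  gcongr
  exact div_le_self (by positivity) hk

/-- Termwise fractional integration of order `1 - α`. -/
lemma rlIntegral_tsum {α γ τ : ℝ} (hα0 : 0 < α) (hα1 : α < 1) (hγ : 0 < γ) (hτ : 0 < τ)
    {a : ℕ → ℝ} (ha : Summable fun k => |rlDerivCoeff α γ a k| * (τ ^ γ) ^ k) :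
    (1 / Real.Gamma (1 - α)) *
        ∫ s in Set.Ioo 0 τ, (τ - s) ^ ((1 - α) - 1) * ∑' k : ℕ, a k * s ^ (α + k * γ) =
      ∑' k : ℕ, rlDerivCoeff α γ a k * (τ ^ (k * γ + 1) / (k * γ + 1)) := by
  have hΓ : 0 < Real.Gamma (1 - α) := Real.Gamma_pos_of_pos (by linarith)
  set f : ℕ → ℝ → ℝ := fun k s => a k * ((τ - s) ^ ((1 - α) - 1) * s ^ (α + k * γ)) with hf
  have hval (k : ℕ) (c : ℝ) : ∫ s in Set.Ioo 0 τ,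
      c * ((τ - s) ^ ((1 - α) - 1) * s ^ (α + k * γ)) = Real.Gamma (1 - α) *
        (c * (Real.Gamma (α + k * γ + 1) / Real.Gamma (k * γ + 1)) *
          (τ ^ (k * γ + 1) / (k * γ + 1))) := by
    rw [integral_const_mul, integral_sub_rpow_mul_rpow_add hα0 hα1 hγ hτ]
    ring
  have hnorm (k : ℕ) : ∫ s in Set.Ioo 0 τ, ‖f k s‖ = Real.Gamma (1 - α) *
      ‖rlDerivCoeff α γ a k * (τ ^ (k * γ + 1) / (k * γ + 1))‖ := by
    have hG₁ := Real.Gamma_pos_of_pos (show 0 < α + k * γ + 1 by positivity)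
    have hG₂ := Real.Gamma_pos_of_pos (show 0 < k * γ + 1 by positivity)
    rw [rlDerivCoeff, norm_mul, norm_mul, Real.norm_of_nonneg (div_pos hG₁ hG₂).le,
      Real.norm_of_nonneg (show 0 ≤ τ ^ (k * γ + 1) / (k * γ + 1) by positivity), ← hval]
    refine setIntegral_congr_fun measurableSet_Ioo fun s hs => ?_
    have h₁ : 0 < τ - s := sub_pos.2 hs.2
    have h₂ : 0 < s := hs.1
    simp only [hf, norm_mul]
    rw [Real.norm_of_nonneg (show 0 ≤ (τ - s) ^ ((1 - α) - 1) by positivity),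
      Real.norm_of_nonneg (show 0 ≤ s ^ (α + k * γ) by positivity)]
  have hsum : Summable fun k => ∫ s in Set.Ioo 0 τ, ‖f k s‖ := by
    simp only [hnorm]
    exact (Summable.of_nonneg_of_le (fun _ => norm_nonneg _)
      (fun k => norm_mul_rpow_div_le hγ hτ _ k) (ha.mul_left τ)).mul_left _
  have hint := integral_tsum_of_summable_integral_norm
    (fun k => (integrableOn_sub_rpow_mul_rpow_add hα0 hα1 hγ hτ k).const_mul (a k)) hsum
  have hswap : ∫ s in Set.Ioo 0 τ, (τ - s) ^ ((1 - α) - 1) * ∑' k : ℕ, a k * s ^ (α + k * γ) =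
      ∫ s in Set.Ioo 0 τ, ∑' k, f k s := by
    congr 1 with s
    rw [← tsum_mul_left]
    exact tsum_congr fun k => by simp only [hf]; ring
  rw [hswap, ← hint, ← tsum_mul_left]
  refine tsum_congr fun k => ?_
  rw [hval, rlDerivCoeff]
  field_simp

lemma hasDerivAt_tsum_mul_rpow_div {γ t : ℝ} (hγ : 0 < γ) (ht : 0 < t) {b : ℕ → ℝ}
    (hb : ∀ r : ℝ, Summable fun k => |b k| * r ^ k) :
    HasDerivAt (fun τ : ℝ => ∑' k : ℕ, b k * (τ ^ (k * γ + 1) / (k * γ + 1)))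
      (∑' k : ℕ, b k * (t ^ γ) ^ k) t := by
  have hmem : t ∈ Set.Ioo 0 (t + 1) := ⟨ht, by linarith⟩
  refine hasDerivAt_tsum_of_isPreconnected (g' := fun k τ => b k * (τ ^ γ) ^ k)
    (hb ((t + 1) ^ γ)) isOpen_Ioo isPreconnected_Ioo ?_ ?_ hmem ?_ hmem
  · intro k y hy
    have hk : (0 : ℝ) < k * γ + 1 := by positivity
    refine (((Real.hasDerivAt_rpow_const (p := k * γ + 1) (Or.inl hy.1.ne')).div_const
      (k * γ + 1)).const_mul (b k)).congr_deriv ?_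
    rw [add_sub_cancel_right, mul_div_cancel_left₀ _ hk.ne', mul_comm (k : ℝ),
      Real.rpow_mul_natCast hy.1.le]
  · intro k y hy
    have hy0 : 0 < y := hy.1
    rw [norm_mul, Real.norm_eq_abs, Real.norm_of_nonneg (by positivity)]
    gcongr
    exact hy.2.le
  · exact Summable.of_norm_bounded ((hb (t ^ γ)).mul_left t)
      fun k => norm_mul_rpow_div_le hγ ht _ k

lemma tendsto_tsum_mul_rpow_div {γ : ℝ} (hγ : 0 < γ) {b : ℕ → ℝ} (hb : Summable fun k => |b k|) :
    Filter.Tendsto (fun τ : ℝ => ∑' k : ℕ, b k * (τ ^ (k * γ + 1) / (k * γ + 1)))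
      (nhdsWithin 0 (Set.Ioi 0)) (nhds 0) := by
  have hlim : Filter.Tendsto (fun τ : ℝ => τ * ∑' k, |b k|) (nhdsWithin 0 (Set.Ioi 0))
      (nhds 0) := by
    refine Filter.Tendsto.mono_left ?_ nhdsWithin_le_nhds
    simpa using (Filter.tendsto_id (α := ℝ) (x := nhds 0)).mul_const (∑' k, |b k|)
  refine squeeze_zero_norm' ?_ hlim
  filter_upwards [Ioo_mem_nhdsGT (zero_lt_one' ℝ)] with τ hτ
  refine tsum_of_norm_bounded (hb.hasSum.mul_left τ) fun k => ?_
  refine (norm_mul_rpow_div_le hγ hτ.1 _ k).trans ?_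
  have hτ0 := hτ.1
  have hpow : (τ ^ γ) ^ k ≤ 1 :=
    pow_le_one₀ (by positivity) (Real.rpow_le_one hτ0.le hτ.2.le hγ.le)
  gcongr
  exact mul_le_of_le_one_right (abs_nonneg _) hpow

lemma rlDerivCoeff_kilbasCoeff_zero (α γ lam : ℝ) :
    rlDerivCoeff α γ (fun k => kilbasCoeff α γ k * lam ^ k) 0 = Real.Gamma (α + 1) := by
  simp [rlDerivCoeff, kilbasCoeff]

lemma rlDerivCoeff_kilbasCoeff_succ {α γ : ℝ} (hα : 0 < α) (hγ : 0 < γ) (lam : ℝ) (k : ℕ) :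
    rlDerivCoeff α γ (fun k => kilbasCoeff α γ k * lam ^ k) (k + 1) =
      lam * (kilbasCoeff α γ k * lam ^ k) := by
  have h₁ := (Real.Gamma_pos_of_pos (show 0 < ((k : ℝ) + 1) * γ + 1 by positivity)).ne'
  have h₂ := (Real.Gamma_pos_of_pos (show 0 < ((k : ℝ) + 1) * γ + 1 + α by positivity)).ne'
  rw [rlDerivCoeff, kilbasCoeff_succ]
  push_cast
  rw [show α + ((k : ℝ) + 1) * γ + 1 = ((k : ℝ) + 1) * γ + 1 + α by ring]
  field_simp
  ring

lemma summable_rlDerivCoeff_kilbasCoeff {α γ : ℝ} (hα0 : 0 < α) (hα1 : α < 1) (hγ : 0 < γ)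
    (lam r : ℝ) :
    Summable fun k =>
      |rlDerivCoeff α γ (fun k => kilbasCoeff α γ k * lam ^ k) k| * r ^ k := by
  rw [← summable_nat_add_iff 1]
  refine ((summable_kilbasCoeff_mul_pow hα0 hα1 hγ (|lam| * r)).mul_left (|lam| * r)).congr
    fun k => ?_
  rw [rlDerivCoeff_kilbasCoeff_succ hα0 hγ, abs_mul, abs_mul, abs_pow,
    abs_of_pos (kilbasCoeff_pos hα0 hγ k)]
  ring

lemma tsum_rlDerivCoeff_kilbasCoeff {α γ : ℝ} (hα0 : 0 < α) (hα1 : α < 1) (hγ : 0 < γ)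
    (lam z : ℝ) (hz : 0 ≤ z) :
    ∑' k, rlDerivCoeff α γ (fun k => kilbasCoeff α γ k * lam ^ k) k * z ^ k =
      Real.Gamma (α + 1) + lam * z * ∑' k, kilbasCoeff α γ k * (lam * z) ^ k := by
  have hs : Summable fun k =>
      rlDerivCoeff α γ (fun k => kilbasCoeff α γ k * lam ^ k) k * z ^ k := by
    refine .of_norm ((summable_rlDerivCoeff_kilbasCoeff hα0 hα1 hγ lam z).congr fun k => ?_)
    rw [norm_mul, Real.norm_eq_abs, Real.norm_of_nonneg (pow_nonneg hz k)]
  rw [hs.tsum_eq_zero_add, rlDerivCoeff_kilbasCoeff_zero, pow_zero, mul_one, ← tsum_mul_left]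
  congr 2 with k
  rw [rlDerivCoeff_kilbasCoeff_succ hα0 hγ]
  ring

/-- The fractional integral of order `1 - α` of `t^α E_{α,1+β/α,1+β/α}(λ t^(α+β))`. -/
lemma rlIntegral_kilbasML {α β τ : ℝ} (hα0 : 0 < α) (hα1 : α < 1) (hβ : 0 ≤ β) (hτ : 0 < τ)
    (lam : ℝ) :
    (1 / Real.Gamma (1 - α)) * ∫ s in Set.Ioo 0 τ, (τ - s) ^ ((1 - α) - 1) *
        (s ^ α * kilbasML α (1 + β / α) (1 + β / α) (lam * s ^ (α + β))) =
      ∑' k : ℕ, rlDerivCoeff α (α + β) (fun k => kilbasCoeff α (α + β) k * lam ^ k) k *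
        (τ ^ (k * (α + β) + 1) / (k * (α + β) + 1)) := by
  have hγ : 0 < α + β := by linarith
  rw [← rlIntegral_tsum hα0 hα1 hγ hτ
    (summable_rlDerivCoeff_kilbasCoeff hα0 hα1 hγ lam (τ ^ (α + β)))]
  congr 1
  refine setIntegral_congr_fun measurableSet_Ioo fun s hs => ?_
  rw [kilbasML_eq_tsum_kilbasCoeff hα0.ne', ← tsum_mul_left]
  congr 2 with k
  rw [Real.rpow_add hs.1 α (k * (α + β)), mul_comm (k : ℝ), Real.rpow_mul_natCast hs.1.le]
  ring

/-- `t^α E_{α,1+β/α,1+β/α}(λ t^(α+β))` solves `D^α y = λ t^β y + Γ(α + 1)`. -/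
lemma hasDerivAt_rlIntegral_kilbasML {α β t : ℝ} (hα0 : 0 < α) (hα1 : α < 1) (hβ : 0 ≤ β)
    (ht : 0 < t) (lam : ℝ) :
    HasDerivAt (fun τ : ℝ => (1 / Real.Gamma (1 - α)) * ∫ s in Set.Ioo 0 τ,
        (τ - s) ^ ((1 - α) - 1) *
          (s ^ α * kilbasML α (1 + β / α) (1 + β / α) (lam * s ^ (α + β))))
      (lam * t ^ β * (t ^ α * kilbasML α (1 + β / α) (1 + β / α) (lam * t ^ (α + β))) +
        Real.Gamma (α + 1)) t := by
  have hγ : 0 < α + β := by linarith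
  have h := hasDerivAt_tsum_mul_rpow_div hγ ht
    (summable_rlDerivCoeff_kilbasCoeff hα0 hα1 hγ lam)
  rw [tsum_rlDerivCoeff_kilbasCoeff hα0 hα1 hγ lam _ (by positivity),
    ← kilbasML_eq_tsum_kilbasCoeff hα0.ne'] at h
  have hval : lam * t ^ β * (t ^ α * kilbasML α (1 + β / α) (1 + β / α) (lam * t ^ (α + β))) +
      Real.Gamma (α + 1) = Real.Gamma (α + 1) +
        lam * t ^ (α + β) * kilbasML α (1 + β / α) (1 + β / α) (lam * t ^ (α + β)) := by
    rw [Real.rpow_add ht]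
    ring
  rw [hval]
  refine h.congr_of_eventuallyEq ?_
  filter_upwards [lt_mem_nhds ht] with τ hτ
  exact rlIntegral_kilbasML hα0 hα1 hβ hτ lam

lemma tendsto_rlIntegral_kilbasML {α β : ℝ} (hα0 : 0 < α) (hα1 : α < 1) (hβ : 0 ≤ β)
    (lam : ℝ) :
    Filter.Tendsto (fun τ : ℝ => (1 / Real.Gamma (1 - α)) * ∫ s in Set.Ioo 0 τ,
        (τ - s) ^ ((1 - α) - 1) *
          (s ^ α * kilbasML α (1 + β / α) (1 + β / α) (lam * s ^ (α + β))))
      (nhdsWithin 0 (Set.Ioi 0)) (nhds 0) := by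
  have hγ : 0 < α + β := by linarith
  refine (tendsto_tsum_mul_rpow_div hγ (by
    simpa using summable_rlDerivCoeff_kilbasCoeff hα0 hα1 hγ lam 1)).congr' ?_
  filter_upwards [self_mem_nhdsWithin] with τ hτ
  exact (rlIntegral_kilbasML hα0 hα1 hβ hτ lam).symm

lemma iteratedDeriv_two_const_mul_sin (c ω x : ℝ) :
    iteratedDeriv 2 (fun y => c * Real.sin (ω * y)) x = c * (-ω ^ 2 * Real.sin (ω * x)) := by
  have hω (y : ℝ) : HasDerivAt (fun y => ω * y) ω y := by
    simpa using (hasDerivAt_id y).const_mul ω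
  have h₁ : deriv (fun y => c * Real.sin (ω * y)) = fun y => c * (Real.cos (ω * y) * ω) :=
    funext fun y => ((hω y).sin.const_mul c).deriv
  rw [iteratedDeriv_succ, iteratedDeriv_one, h₁,
    (((hω x).cos.mul_const ω).const_mul c).deriv]
  ring

theorem example_solution_time_degenerate (α β T : ℝ)
    (hα0 : 0 < α) (hα1 : α < 1) (hβ : 0 ≤ β) (hT : 0 < T)
    (hE : kilbasML α (1 + β / α) (1 + β / α) (-π ^ 2 * T ^ (α + β)) ≠ 0) :
    let u : ℝ → ℝ → ℝ := fun t x =>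
      (t ^ α * kilbasML α (1 + β / α) (1 + β / α) (-π ^ 2 * t ^ (α + β))) /
        (T ^ α * kilbasML α (1 + β / α) (1 + β / α) (-π ^ 2 * T ^ (α + β))) *
          Real.sin (π * x)
    let hbar : ℝ → ℝ := fun x =>
      Real.Gamma (α + 1) /
        (T ^ α * kilbasML α (1 + β / α) (1 + β / α) (-π ^ 2 * T ^ (α + β))) *
          Real.sin (π * x)
    -- the equation  ᴿᴸD₀ₜᵅ ū = t^β ∂²ₓū + h̄(x)  on (0,T) × (0,1)
    (∀ t ∈ Set.Ioo (0 : ℝ) T, ∀ x ∈ Set.Ioo (0 : ℝ) 1,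
        HasDerivAt (fun τ : ℝ => (1 / Real.Gamma (1 - α)) *
            ∫ s in Set.Ioo 0 τ, (τ - s) ^ ((1 - α) - 1) * u s x)
          (t ^ β * iteratedDeriv 2 (fun y => u t y) x + hbar x) t) ∧
    -- boundary conditions
    (∀ t ∈ Set.Icc (0 : ℝ) T, u t 0 = 0 ∧ u t 1 = 0) ∧
    -- initial condition  lim_{t→0⁺} (I^{1−α} ū)(t,x) = 0
    (∀ x ∈ Set.Icc (0 : ℝ) 1,
        Filter.Tendsto (fun t : ℝ => (1 / Real.Gamma (1 - α)) *
            ∫ s in Set.Ioo 0 t, (t - s) ^ ((1 - α) - 1) * u s x)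
          (nhdsWithin 0 (Set.Ioi 0)) (nhds 0)) ∧
    -- over-determining condition
    (∀ x ∈ Set.Icc (0 : ℝ) 1, u T x = Real.sin (π * x)) := by
  intro u hbar
  set lam : ℝ := -π ^ 2 with hlam
  set D : ℝ := T ^ α * kilbasML α (1 + β / α) (1 + β / α) (lam * T ^ (α + β)) with hD
  have hD0 : D ≠ 0 := mul_ne_zero (Real.rpow_pos_of_pos hT α).ne' hE
  have hint (x : ℝ) : (fun τ : ℝ => (1 / Real.Gamma (1 - α)) *
      ∫ s in Set.Ioo 0 τ, (τ - s) ^ ((1 - α) - 1) * u s x) =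
      fun τ : ℝ => Real.sin (π * x) / D * ((1 / Real.Gamma (1 - α)) *
        ∫ s in Set.Ioo 0 τ, (τ - s) ^ ((1 - α) - 1) *
          (s ^ α * kilbasML α (1 + β / α) (1 + β / α) (lam * s ^ (α + β)))) := by
    ext τ
    rw [mul_left_comm, ← integral_const_mul (Real.sin (π * x) / D)]
    congr 1
    refine integral_congr_ae (Filter.Eventually.of_forall fun s => ?_)
    simp only [u]
    ring
  refine ⟨fun t ht x _ => ?_, fun t _ => ⟨?_, ?_⟩, fun x _ => ?_, fun x _ => ?_⟩
  · rw [hint]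
    refine ((hasDerivAt_rlIntegral_kilbasML hα0 hα1 hβ ht.1 lam).const_mul
      (Real.sin (π * x) / D)).congr_deriv ?_
    rw [show (fun y => u t y) = fun y =>
      (t ^ α * kilbasML α (1 + β / α) (1 + β / α) (lam * t ^ (α + β))) / D *
        Real.sin (π * y) from rfl, iteratedDeriv_two_const_mul_sin, ← hlam]
    simp only [hbar]
    ring
  · simp [u]
  · simp [u]
  · rw [hint]
    simpa using (tendsto_rlIntegral_kilbasML hα0 hα1 hβ lam).const_mul (Real.sin (π * x) / D)
  · simp only [u]
    rw [← hD, div_self hD0, one_mul]
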